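/- arXiv:2602.13354 — 2 statements merged into one kernel-verified Lean document; each statement's English description precedes it below -/
import Mathlib

section
/- Let p be a prime, e a nonnegative integer, and G a finite p-group whose order is divisible by p^{e+1}. Let Γ_{p,e}(G) be the poset of pairs (H, φ) with H ≤ G, |H| ≥ p^{e+1}, φ ∈ Irr(H), ordered by (K, ψ) ≤ (H, φ) iff K ≤ H and [φ_K, ψ] ≠ 0. Then for any fixed subgroup H of G with |H| ≥ p^{e+1}, every connected component of Γ_{p,e}(G) contains a pair of the form (H, φ) with φ ∈ Irr(H). -/
open scoped BigOperators Classical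

noncomputable section

/-- Inner product of class functions on a finite group. -/
def charInner (G : Type*) [Group G] [Fintype G] (f g : G → ℂ) : ℂ :=
  (Fintype.card G : ℂ)⁻¹ * ∑ x : G, f x * (starRingEnd ℂ) (g x)

/-- `χ` is the character of some finite-dimensional complex representation. -/
def IsChar (G : Type*) [Group G] (χ : G → ℂ) : Prop :=
  ∃ (n : ℕ) (ρ : Representation ℂ G (Fin n → ℂ)),
    ∀ g : G, χ g = LinearMap.trace ℂ (Fin n → ℂ) (ρ g)

/-- Irreducible character: a character of norm one. -/
def IsIrrChar (G : Type*) [Group G] [Fintype G] (χ : G → ℂ) : Prop :=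
  IsChar G χ ∧ charInner G χ χ = 1

/-- Restriction of a character of `H` to a smaller subgroup `K ≤ H`. -/
def resChar {G : Type*} [Group G] {K H : Subgroup G} (h : K ≤ H) (φ : H → ℂ) :
    K → ℂ := fun k => φ (Subgroup.inclusion h k)

/-- Induced class function from a subgroup `H` up to `G`. -/
def inducedChar {G : Type*} [Group G] [Fintype G] (H : Subgroup G) (α : H → ℂ) :
    G → ℂ := fun g =>
  (Fintype.card H : ℂ)⁻¹ *
    ∑ x : G, if h : x * g * x⁻¹ ∈ H then α ⟨x * g * x⁻¹, h⟩ else 0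

/-- Induced class function from a subgroup `A` up to a larger subgroup `B`. -/
def inducedCharSub {G : Type*} [Group G] [Fintype G] {A B : Subgroup G}
    (_ : A ≤ B) (η : A → ℂ) : B → ℂ := fun b =>
  (Fintype.card A : ℂ)⁻¹ *
    ∑ x : B, if h : (x : G) * (b : G) * (x : G)⁻¹ ∈ A then η ⟨_, h⟩ else 0
/-- Elements of the poset `Γ_{p,e}(G)`: pairs `(H, φ)` with `|H| ≥ p^(e+1)` and
`φ ∈ Irr(H)`. -/
structure GammaPair (p e : ℕ) (G : Type*) [Group G] [Fintype G] where
  H : Subgroup G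
  hH : p ^ (e + 1) ≤ Fintype.card H
  φ : H → ℂ
  hφ : IsIrrChar H φ

/-- The partial order on `Γ_{p,e}(G)`: `(K, ψ) ≤ (H, φ)` iff `K ≤ H` and
`[φ_K, ψ] ≠ 0`. -/
def GammaLe {p e : ℕ} {G : Type*} [Group G] [Fintype G]
    (a b : GammaPair p e G) : Prop :=
  ∃ h : a.H ≤ b.H, charInner a.H (resChar h b.φ) a.φ ≠ 0

/-- Two elements of `Γ_{p,e}(G)` are connected if joined by a finite zigzag of
comparable pairs. -/
def GammaConnected {p e : ℕ} {G : Type*} [Group G] [Fintype G]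
    (a b : GammaPair p e G) : Prop :=
  Relation.EqvGen (fun x y => GammaLe x y ∨ GammaLe y x) a b

/-- The setoid of connectedness on `Γ_{p,e}(G)`; its quotient is `π₀(Γ_{p,e}(G))`. -/
def gammaSetoid (p e : ℕ) (G : Type*) [Group G] [Fintype G] :
    Setoid (GammaPair p e G) :=
  Relation.EqvGen.setoid (fun x y => GammaLe x y ∨ GammaLe y x)

/-- The character of any finite-dimensional complex representation is a character. -/
theorem Representation.isChar_character {G V : Type*} [Group G] [AddCommGroup V] [Module ℂ V]
    [FiniteDimensional ℂ V] (ρ : Representation ℂ G V) : IsChar G ρ.character := by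
  let b := (Module.finBasis ℂ V).equivFun
  refine ⟨Module.finrank ℂ V,
    { toFun := fun g => b.conj (ρ g)
      map_one' := by ext; simp [LinearEquiv.conj_apply]
      map_mul' := fun g h => by ext; simp [LinearEquiv.conj_apply] }, fun g => ?_⟩
  exact (LinearMap.trace_conj' (ρ g) b).symm

open scoped Matrix ComplexOrder in
/-- Averaging the standard Hermitian form shows that a complex matrix representation of a finite
group is unitarizable, so its trace at `g⁻¹` is the conjugate of its trace at `g`. -/
theorem Matrix.trace_map_inv_eq_star {G ι : Type*} [Group G] [Fintype G] [Fintype ι]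
    [DecidableEq ι] (A : G →* Matrix ι ι ℂ) (g : G) :
    (A g⁻¹).trace = star (A g).trace := by
  let P : Matrix ι ι ℂ := ∑ x : G, (A x)ᴴ * A x
  have hP : P.PosDef := by
    have h1 : P = (A 1)ᴴ * A 1 + ∑ x ∈ Finset.univ.erase 1, (A x)ᴴ * A x :=
      (Finset.add_sum_erase _ _ (Finset.mem_univ 1)).symm
    rw [h1]
    refine Matrix.PosDef.add_posSemidef ?_ ?_
    · simpa using Matrix.PosDef.one
    · exact Matrix.posSemidef_sum _ fun x _ => Matrix.posSemidef_conjTranspose_mul_self (A x)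
  have hdet : IsUnit P.det := (Matrix.isUnit_iff_isUnit_det P).1 hP.isUnit
  have hinv : (A g)ᴴ * P * A g = P := by
    simp only [P, Finset.mul_sum, Finset.sum_mul]
    refine Fintype.sum_bijective (· * g) (Group.mulRight_bijective g) _ _ fun x => ?_
    simp [Matrix.conjTranspose_mul, Matrix.mul_assoc]
  have hg : A g * A g⁻¹ = 1 := by rw [← map_mul, mul_inv_cancel, map_one]
  have hconj : (A g)ᴴ * P = P * A g⁻¹ := by
    rw [← mul_one ((A g)ᴴ * P), ← hg, ← Matrix.mul_assoc, hinv]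
  rw [← Matrix.trace_conjTranspose, ← Matrix.mul_nonsing_inv_cancel_right P (A g)ᴴ hdet, hconj,
    Matrix.trace_mul_comm, ← Matrix.mul_assoc, Matrix.nonsing_inv_mul P hdet, one_mul]

theorem Representation.character_inv_eq_star {G V : Type*} [Group G] [Fintype G] [AddCommGroup V]
    [Module ℂ V] [FiniteDimensional ℂ V] (ρ : Representation ℂ G V) (g : G) :
    ρ.character g⁻¹ = star (ρ.character g) := by
  let b := Module.finBasis ℂ V
  have h := Matrix.trace_map_inv_eq_star
    ((MonoidHomClass.toMonoidHom (LinearMap.toMatrixAlgEquiv b)).comp ρ) g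
  simpa only [Representation.character, LinearMap.trace_eq_matrix_trace ℂ b] using! h

theorem Representation.IsIrreducible.isIrrChar {G V : Type*} [Group G] [Fintype G]
    [AddCommGroup V] [Module ℂ V] [FiniteDimensional ℂ V] (ρ : Representation ℂ G V)
    [ρ.IsIrreducible] : IsIrrChar G ρ.character := by
  refine ⟨ρ.isChar_character, ?_⟩
  have := invertibleOfNonzero (NeZero.ne (Nat.card G : ℂ))
  have h := Representation.char_orthonormal ρ ρ
  rw [if_pos ⟨Representation.Equiv.refl ρ⟩, Nat.card_eq_fintype_card] at h
  simpa only [charInner, starRingEnd_apply, ρ.character_inv_eq_star] using h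

theorem LinearMap.trace_eq_add_trace_restrict_of_isCompl {V : Type*} [AddCommGroup V]
    [Module ℂ V] [FiniteDimensional ℂ V] {p q : Submodule ℂ V} (h : IsCompl p q)
    (f : V →ₗ[ℂ] V) (hp : ∀ v ∈ p, f v ∈ p) (hq : ∀ v ∈ q, f v ∈ q) :
    LinearMap.trace ℂ V f =
      LinearMap.trace ℂ p (f.restrict hp) + LinearMap.trace ℂ q (f.restrict hq) := by
  rw [← LinearMap.trace_prodMap', ← LinearMap.trace_conj' _ (p.prodEquivOfIsCompl q h)]
  congr 1
  ext v
  obtain ⟨⟨x, y⟩, rfl⟩ := (p.prodEquivOfIsCompl q h).surjective v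
  simp [LinearEquiv.conj_apply]

/-- A character of a finite group is a sum of irreducible ones, so an additive functional that does
not vanish on it does not vanish on some irreducible character. -/
theorem Representation.exists_isIrrChar_map_ne_zero {G V : Type*} [Group G] [Fintype G]
    [AddCommGroup V] [Module ℂ V] [FiniteDimensional ℂ V] (ρ : Representation ℂ G V)
    (L : (G → ℂ) →+ ℂ) (hL : L ρ.character ≠ 0) :
    ∃ χ, IsIrrChar G χ ∧ L χ ≠ 0 := by
  induction hn : Module.finrank ℂ V using Nat.strong_induction_on generalizing V with
  | _ n ih =>
  by_cases hirr : ρ.IsIrreducible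
  · exact ⟨_, Representation.IsIrreducible.isIrrChar ρ, hL⟩
  have hnt : Nontrivial (Subrepresentation ρ) := by
    refine ⟨⟨⊥, ⊤, fun hbt => hL ?_⟩⟩
    have h0 : (⊥ : Submodule ℂ V) = ⊤ := congrArg Subrepresentation.toSubmodule hbt
    have hs : Subsingleton V := Submodule.subsingleton_iff ℂ |>.1 (subsingleton_of_bot_eq_top h0)
    have hz : ρ.character = 0 := by
      funext g
      simp [Representation.character, Subsingleton.elim (ρ g) 0]
    rw [hz, map_zero]
  obtain ⟨W, hW0, hW1⟩ : ∃ W : Subrepresentation ρ, W ≠ ⊥ ∧ W ≠ ⊤ := by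
    by_contra! hc
    exact hirr ⟨fun W => or_iff_not_imp_left.2 (hc W)⟩
  obtain ⟨W', hW'⟩ := exists_isCompl W
  have hc : IsCompl W.toSubmodule W'.toSubmodule :=
    IsCompl.of_eq (congrArg Subrepresentation.toSubmodule hW'.inf_eq_bot)
      (congrArg Subrepresentation.toSubmodule hW'.sup_eq_top)
  have hW'1 : W' ≠ ⊤ := by
    rintro rfl
    exact hW0 (by simpa using hW'.inf_eq_bot)
  have hlt : ∀ U : Subrepresentation ρ, U ≠ ⊤ → Module.finrank ℂ U.toSubmodule < n := by
    intro U hU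
    rw [← hn]
    exact Submodule.finrank_lt fun h => hU (Subrepresentation.toSubmodule_injective h)
  have hadd : ρ.character = W.toRepresentation.character + W'.toRepresentation.character := by
    funext g
    exact LinearMap.trace_eq_add_trace_restrict_of_isCompl hc (ρ g)
      (fun _ hv => W.apply_mem_toSubmodule g hv) (fun _ hv => W'.apply_mem_toSubmodule g hv)
  by_cases h1 : L W.toRepresentation.character = 0
  · refine ih _ (hlt W' hW'1) W'.toRepresentation (fun h2 => hL ?_) rfl
    rw [hadd, map_add, h1, h2, add_zero]
  · exact ih _ (hlt W hW1) W.toRepresentation h1 rfl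

/-- The right regular representation on functions. -/
def rightRegularFun (G : Type*) [Group G] : Representation ℂ G (G → ℂ) where
  toFun g := LinearMap.funLeft ℂ ℂ (· * g)
  map_one' := by ext; simp [LinearMap.funLeft]
  map_mul' g h := by
    refine LinearMap.ext fun f => funext fun x => ?_
    simp [LinearMap.funLeft, mul_assoc]

theorem character_rightRegularFun {G : Type*} [Group G] [Fintype G] (g : G) :
    (rightRegularFun G).character g = if g = 1 then (Fintype.card G : ℂ) else 0 := by
  rw [Representation.character, LinearMap.trace_eq_matrix_trace ℂ (Pi.basisFun ℂ G)]
  split_ifs with h <;>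
    simp [Matrix.trace, rightRegularFun, LinearMap.funLeft, h]

theorem charInner_self_ne_zero {G : Type*} [Group G] [Fintype G] {f : G → ℂ} (hf : f 1 ≠ 0) :
    charInner G f f ≠ 0 := by
  have h : ∑ x : G, f x * (starRingEnd ℂ) (f x) = ((∑ x : G, Complex.normSq (f x) : ℝ) : ℂ) := by
    simp [Complex.mul_conj]
  refine mul_ne_zero (inv_ne_zero (Nat.cast_ne_zero.2 Fintype.card_ne_zero)) ?_
  rw [h, Complex.ofReal_ne_zero]
  exact (Finset.sum_pos' (fun x _ => Complex.normSq_nonneg _)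
    ⟨1, Finset.mem_univ _, Complex.normSq_pos.2 hf⟩).ne'

theorem IsIrrChar.apply_one_ne_zero {G : Type*} [Group G] [Fintype G] {χ : G → ℂ}
    (hχ : IsIrrChar G χ) : χ 1 ≠ 0 := by
  obtain ⟨⟨n, ρ, hρ⟩, h1⟩ := hχ
  intro h
  have hn : n = 0 := by simpa [hρ 1] using h
  subst hn
  have hz : χ = 0 := by
    funext g
    simp [hρ g, Subsingleton.elim (ρ g) 0]
  simp [charInner, hz] at h1

theorem charInner_add_left {G : Type*} [Group G] [Fintype G] (f₁ f₂ g : G → ℂ) :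
    charInner G (f₁ + f₂) g = charInner G f₁ g + charInner G f₂ g := by
  simp [charInner, add_mul, Finset.sum_add_distrib, mul_add]

theorem charInner_add_right {G : Type*} [Group G] [Fintype G] (f g₁ g₂ : G → ℂ) :
    charInner G f (g₁ + g₂) = charInner G f g₁ + charInner G f g₂ := by
  simp [charInner, Finset.sum_add_distrib, mul_add]

/-- Every irreducible character of a subgroup is a constituent of the restriction of an irreducible
character of any larger subgroup. -/
theorem exists_isIrrChar_over {G : Type*} [Group G] [Fintype G] {K H : Subgroup G} (h : K ≤ H)
    {ψ : K → ℂ} (hψ : IsIrrChar K ψ) :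
    ∃ χ : H → ℂ, IsIrrChar H χ ∧ charInner K (resChar h χ) ψ ≠ 0 := by
  let L : (H → ℂ) →+ ℂ := AddMonoidHom.mk' (fun χ => charInner K (resChar h χ) ψ)
    fun a b => charInner_add_left (resChar h a) (resChar h b) ψ
  refine (rightRegularFun H).exists_isIrrChar_map_ne_zero L ?_
  have hval : L (rightRegularFun H).character =
      (Fintype.card K : ℂ)⁻¹ * ((Fintype.card H : ℂ) * (starRingEnd ℂ) (ψ 1)) := by
    change charInner K _ ψ = _
    simp only [charInner, resChar, character_rightRegularFun]
    rw [Finset.sum_eq_single 1]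
    · simp
    · intro x _ hx
      have : Subgroup.inclusion h x ≠ 1 := fun hx1 =>
        hx (Subgroup.inclusion_injective h (hx1.trans (map_one _).symm))
      simp [this]
    · simp
  rw [hval]
  have := hψ.apply_one_ne_zero
  simp [this]

/-- The restriction of an irreducible character to a subgroup has an irreducible constituent. -/
theorem exists_isIrrChar_under {G : Type*} [Group G] [Fintype G] {K H : Subgroup G} (h : K ≤ H)
    {χ : H → ℂ} (hχ : IsIrrChar H χ) :
    ∃ ψ : K → ℂ, IsIrrChar K ψ ∧ charInner K (resChar h χ) ψ ≠ 0 := by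
  obtain ⟨n, ρ, hρ⟩ := hχ.1
  let L : (K → ℂ) →+ ℂ := AddMonoidHom.mk' (charInner K (resChar h χ))
    (charInner_add_right (resChar h χ))
  let σ : Representation ℂ K (Fin n → ℂ) := ρ.comp (Subgroup.inclusion h)
  have hσ : σ.character = resChar h χ := funext fun k => (hρ _).symm
  refine σ.exists_isIrrChar_map_ne_zero L ?_
  rw [hσ]
  refine charInner_self_ne_zero ?_
  simpa [resChar] using hχ.apply_one_ne_zero

/-- Lemma 4 of Meng–Yang: for a fixed subgroup `H` with
`|H| ≥ p^(e+1)` of a finite `p`-group `G` with `p^(e+1) ∣ |G|`, every connected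
component of `Γ_{p,e}(G)` contains a pair `(H, φ)`. -/
theorem every_component_meets_fixed_subgroup {p e : ℕ} (hp : p.Prime)
    {G : Type*} [Group G] [Fintype G] (hG : IsPGroup p G)
    (hdvd : p ^ (e + 1) ∣ Fintype.card G)
    (H : Subgroup G) (hH : p ^ (e + 1) ≤ Fintype.card H)
    (a : GammaPair p e G) :
    ∃ (φ : H → ℂ) (hφ : IsIrrChar H φ),
      GammaConnected a ⟨H, hH, φ, hφ⟩ := by
  obtain ⟨χ, hχ, haχ⟩ := exists_isIrrChar_over (le_top : a.H ≤ ⊤) a.hφ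
  obtain ⟨φ, hφ, hφχ⟩ := exists_isIrrChar_under (le_top : H ≤ ⊤) hχ
  have hcard : p ^ (e + 1) ≤ Fintype.card (⊤ : Subgroup G) :=
    hH.trans (Fintype.card_le_of_injective _ (Subgroup.inclusion_injective le_top))
  let top : GammaPair p e G := ⟨⊤, hcard, χ, hχ⟩
  exact ⟨φ, hφ, Relation.EqvGen.trans _ top _ (.rel _ _ (.inl ⟨le_top, haχ⟩))
    (.rel _ _ (.inr ⟨le_top, hφχ⟩))⟩
end
end

section
/- Let p be a prime, e ≥ 0, and G a finite p-group with p^{e+1} dividing |G|. Let I be the intersection of all subgroups of G of order p^{e+1}. Then the poset Γ_{p,e}(G) is connected if and only if I = 1. -/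
open scoped BigOperators Classical

noncomputable section

section Characters

open Representation
open scoped ComplexOrder

variable {G V W : Type*} [Group G] [AddCommGroup V] [Module ℂ V]
  [AddCommGroup W] [Module ℂ W]

/-- A finite-dimensional representation of a finite group preserves the positive definite form
obtained by averaging, so inverting a group element conjugates the character value. -/
theorem Representation.character_inv_eq_conj [Finite G] [FiniteDimensional ℂ V]
    (ρ : Representation ℂ G V) (g : G) :
    ρ.character g⁻¹ = starRingEnd ℂ (ρ.character g) := by
  have := Fintype.ofFinite G
  let b := Module.finBasis ℂ V
  let A : G → Matrix _ _ ℂ := fun x => LinearMap.toMatrix b b (ρ x)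
  have hA_mul (x y : G) : A (x * y) = A x * A y := by
    simp [A, LinearMap.toMatrix_mul]
  have hA_one : A 1 = 1 := by simp [A]
  let P : Matrix _ _ ℂ := ∑ x, (A x).conjTranspose * A x
  have hP : P.PosDef := by
    have h : P = 1 + ∑ x ∈ Finset.univ.erase (1 : G), (A x).conjTranspose * A x := by
      simp only [P]
      rw [← Finset.add_sum_erase _ _ (Finset.mem_univ (1 : G))]
      simp [hA_one]
    rw [h]
    exact Matrix.PosDef.one.add_posSemidef
      (Matrix.posSemidef_sum _ fun x _ => Matrix.posSemidef_conjTranspose_mul_self _)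
  have hdet : IsUnit P.det := (Matrix.isUnit_iff_isUnit_det P).mp hP.isUnit
  have hPg : (A g).conjTranspose * P * A g = P := by
    simp only [P, Finset.mul_sum, Finset.sum_mul]
    refine Fintype.sum_equiv (Equiv.mulRight g) _ _ fun x => ?_
    simp [hA_mul, Matrix.conjTranspose_mul, mul_assoc]
  have hinv : A g * A g⁻¹ = 1 := by rw [← hA_mul, mul_inv_cancel, hA_one]
  have key : A g⁻¹ = P⁻¹ * ((A g).conjTranspose * P) := by
    calc A g⁻¹ = P⁻¹ * (P * A g⁻¹) := by rw [← mul_assoc, Matrix.nonsing_inv_mul _ hdet, one_mul]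
      _ = P⁻¹ * (((A g).conjTranspose * P * A g) * A g⁻¹) := by rw [hPg]
      _ = _ := by rw [mul_assoc (_ * P), hinv, mul_one]
  have htr (x : G) : ρ.character x = (A x).trace := LinearMap.trace_eq_matrix_trace ℂ b (ρ x)
  rw [htr, htr, key, Matrix.trace_mul_comm, mul_assoc, Matrix.mul_nonsing_inv _ hdet, mul_one,
    Matrix.trace_conjTranspose]
  rfl

variable [Fintype G]

theorem charInner_character [FiniteDimensional ℂ V] [FiniteDimensional ℂ W]
    (ρ : Representation ℂ G V) (σ : Representation ℂ G W) :
    charInner G σ.character ρ.character = Module.finrank ℂ (IntertwiningMap ρ σ) := by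
  have : Invertible (Nat.card G : ℂ) := invertibleOfNonzero (by simp)
  rw [← card_inv_mul_sum_char_mul_char_eq_finrank ρ σ]
  simp [charInner, character_inv_eq_conj]

theorem conj_charInner (f g : G → ℂ) : starRingEnd ℂ (charInner G f g) = charInner G g f := by
  simp [charInner, mul_comm]

instance [FiniteDimensional ℂ V] [FiniteDimensional ℂ W]
    (ρ : Representation ℂ G V) (σ : Representation ℂ G W) :
    FiniteDimensional ℂ (IntertwiningMap ρ σ) :=
  FiniteDimensional.of_injective (IntertwiningMap.toLinearMapl (ρ := ρ) (σ := σ))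
    (IntertwiningMap.toLinearMap_injective ρ σ)

theorem charInner_character_ne_zero_iff [FiniteDimensional ℂ V] [FiniteDimensional ℂ W]
    (ρ : Representation ℂ G V) (σ : Representation ℂ G W) :
    charInner G σ.character ρ.character ≠ 0 ↔ ∃ f : IntertwiningMap ρ σ, f ≠ 0 := by
  rw [charInner_character, Nat.cast_ne_zero, ← Nat.pos_iff_ne_zero,
    Module.finrank_pos_iff_exists_ne_zero]

theorem charInner_ne_zero_comm {f g : G → ℂ} : charInner G f g ≠ 0 ↔ charInner G g f ≠ 0 := by
  rw [← conj_charInner g f, ne_eq, map_eq_zero]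

theorem isIrrChar_character [FiniteDimensional ℂ V] (ρ : Representation ℂ G V)
    (hρ : ρ.IsIrreducible) : IsIrrChar G ρ.character := by
  refine ⟨⟨Module.finrank ℂ V, ?_⟩, ?_⟩
  · let e : V ≃ₗ[ℂ] (Fin (Module.finrank ℂ V) → ℂ) := (Module.finBasis ℂ V).equivFun
    refine ⟨(e.conjRingEquiv : Module.End ℂ V →* _).comp ρ, fun g => ?_⟩
    exact (LinearMap.trace_conj' (ρ g) e).symm
  · rw [charInner_character, IsIrreducible.finrank_intertwiningMap_self, Nat.cast_one]

omit [Fintype G] in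
/-- Maschke's theorem: every subrepresentation is the image of an equivariant projection. -/
theorem Subrepresentation.exists_equivariant_projection [Finite G] {ρ : Representation ℂ G V}
    (P : Subrepresentation ρ) :
    ∃ π : IntertwiningMap ρ P.toRepresentation, ∀ v : P.toSubmodule, π v = v := by
  obtain ⟨Q, hQ⟩ := exists_isCompl P
  have hPQ : IsCompl P.toSubmodule Q.toSubmodule :=
    ⟨disjoint_iff.mpr congr(($hQ.inf_eq_bot).toSubmodule),
      codisjoint_iff.mpr congr(($hQ.sup_eq_top).toSubmodule)⟩
  refine ⟨LinearMap.intertwiningMap_of_isIntertwiningMap _ _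
    (P.toSubmodule.projectionOnto Q.toSubmodule hPQ) fun g v => ?_,
    fun v => Submodule.projectionOnto_apply_left hPQ v⟩
  obtain ⟨x, hx, y, hy, rfl⟩ :=
    Submodule.mem_sup.mp (hPQ.sup_eq_top ▸ Submodule.mem_top : v ∈ P.toSubmodule ⊔ Q.toSubmodule)
  have h1 := Submodule.projectionOnto_apply_left hPQ ⟨x, hx⟩
  have h2 := Submodule.projectionOnto_apply_right hPQ ⟨y, hy⟩
  have h3 := Submodule.projectionOnto_apply_left hPQ ⟨ρ g x, P.apply_mem_toSubmodule g hx⟩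
  have h4 := Submodule.projectionOnto_apply_right hPQ ⟨ρ g y, Q.apply_mem_toSubmodule g hy⟩
  simp only at h1 h2 h3 h4
  simp only [map_add, h1, h2, h3, h4, add_zero]
  rfl

/-- A representation all of whose self-intertwining maps are scalars is irreducible. -/
theorem isIrreducible_of_finrank_intertwiningMap_self [FiniteDimensional ℂ V]
    (ρ : Representation ℂ G V) (h : Module.finrank ℂ (IntertwiningMap ρ ρ) = 1) :
    ρ.IsIrreducible := by
  have hid : IntertwiningMap.id ρ ≠ 0 := by
    intro h0
    have : Subsingleton (IntertwiningMap ρ ρ) := ⟨fun f g => by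
      ext v
      have hv : v = 0 := congr($h0 v)
      simp [hv]⟩
    simp [Module.finrank_zero_of_subsingleton] at h
  have hnt : Nontrivial V := by
    by_contra hV
    rw [not_nontrivial_iff_subsingleton] at hV
    exact hid (by ext v; exact Subsingleton.elim _ _)
  refine { exists_pair_ne := ⟨⊥, ⊤, fun hbt => ?_⟩, eq_bot_or_eq_top := fun P => ?_ }
  · exact bot_ne_top (α := Submodule ℂ V) congr(($hbt).toSubmodule)
  obtain ⟨π, hπ⟩ := P.exists_equivariant_projection
  let i : IntertwiningMap P.toRepresentation ρ :=
    LinearMap.intertwiningMap_of_isIntertwiningMap _ _ P.toSubmodule.subtype fun _ _ => rfl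
  obtain ⟨c, hc⟩ := (finrank_eq_one_iff_of_nonzero' _ hid).mp h (i.comp π)
  have hc' (v : V) : c • v = π v := congr($hc v)
  by_cases hc0 : c = 0
  · left
    refine Subrepresentation.toSubmodule_injective ((Submodule.eq_bot_iff _).mpr fun v hv => ?_)
    have := hc' v
    rwa [hc0, zero_smul, hπ ⟨v, hv⟩, eq_comm] at this
  · right
    refine Subrepresentation.toSubmodule_injective (Submodule.eq_top_iff'.mpr fun v => ?_)
    rw [← inv_smul_smul₀ hc0 v, hc' v]
    exact P.toSubmodule.smul_mem _ (π v).2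

theorem IsIrrChar.exists_representation {χ : G → ℂ} (hχ : IsIrrChar G χ) :
    ∃ (n : ℕ) (ρ : Representation ℂ G (Fin n → ℂ)), ρ.IsIrreducible ∧ χ = ρ.character := by
  obtain ⟨⟨n, ρ, hρ⟩, h1⟩ := hχ
  obtain rfl : χ = ρ.character := funext hρ
  refine ⟨n, ρ, isIrreducible_of_finrank_intertwiningMap_self ρ ?_, rfl⟩
  rw [charInner_character] at h1
  exact_mod_cast h1

end Characters

section Subrepresentations

variable {G V W : Type*} [Group G] [AddCommGroup V] [Module ℂ V]
  [AddCommGroup W] [Module ℂ W]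

/-- An atom of the lattice of subrepresentations is an irreducible representation. -/
theorem Subrepresentation.isIrreducible_of_isAtom {ρ : Representation ℂ G V}
    {P : Subrepresentation ρ} (hP : IsAtom P) : P.toRepresentation.IsIrreducible := by
  refine { exists_pair_ne := ⟨⊥, ⊤, fun h => hP.1 ?_⟩, eq_bot_or_eq_top := fun Q => ?_ }
  · refine toSubmodule_injective ((Submodule.eq_bot_iff _).mpr fun v hv => ?_)
    have : (⟨v, hv⟩ : P.toSubmodule) ∈ (⊥ : Subrepresentation P.toRepresentation).toSubmodule := by
      rw [h]; exact Submodule.mem_top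
    exact congr_arg Subtype.val ((Submodule.mem_bot ℂ).mp this)
  · let Q' : Subrepresentation ρ :=
      ⟨Q.toSubmodule.map P.toSubmodule.subtype, by
        rintro g _ ⟨v, hv, rfl⟩
        exact ⟨P.toRepresentation g v, Q.apply_mem_toSubmodule g hv, rfl⟩⟩
    have hQ' : Q' ≤ P := Submodule.map_subtype_le _ _
    rcases hP.le_iff.mp hQ' with h | h
    · left
      refine toSubmodule_injective ((Submodule.eq_bot_iff _).mpr fun v hv => ?_)
      have : (v : V) ∈ Q'.toSubmodule := ⟨v, hv, rfl⟩
      rw [h] at this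
      exact Subtype.ext ((Submodule.mem_bot ℂ).mp this)
    · right
      refine toSubmodule_injective (Submodule.eq_top_iff'.mpr fun v => ?_)
      have : (v : V) ∈ Q'.toSubmodule := by rw [h]; exact v.2
      obtain ⟨w, hw, hwv⟩ := this
      rwa [← Subtype.ext hwv]

/-- A subrepresentation of a finite-dimensional representation of a finite group is contained in
any subspace that contains all of its irreducible subrepresentations. -/
theorem Subrepresentation.le_of_forall_irreducible_le [Finite G] [FiniteDimensional ℂ V]
    {ρ : Representation ℂ G V} (P : Subrepresentation ρ) (U : Submodule ℂ V)
    (h : ∀ Q ≤ P, Q.toRepresentation.IsIrreducible → Q.toSubmodule ≤ U) : P.toSubmodule ≤ U := by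
  induction hn : Module.finrank ℂ P.toSubmodule using Nat.strong_induction_on generalizing P with
  | _ n ih =>
    have ih' (R : Subrepresentation ρ) (hR : R < P) : R.toSubmodule ≤ U :=
      ih _ (hn ▸ Submodule.finrank_lt_finrank_of_lt hR) R (fun Q hQ => h Q (hQ.trans hR.le)) rfl
    by_cases hatom : IsAtom P
    · exact h P le_rfl (isIrreducible_of_isAtom hatom)
    by_cases hbot : P = ⊥
    · rw [hbot]; exact bot_le
    obtain ⟨R, hRP, hR⟩ : ∃ R, R < P ∧ R ≠ ⊥ := by
      by_contra! hall
      exact hatom ⟨hbot, hall⟩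
    obtain ⟨R', hR'⟩ := exists_isCompl R
    have hsub : R'.toSubmodule ⊓ P.toSubmodule ≤ U := by
      refine ih' (R' ⊓ P) (lt_of_le_of_ne inf_le_right fun heq => hR ?_)
      exact le_bot_iff.mp (hR'.inf_eq_bot ▸ le_inf le_rfl (hRP.le.trans (inf_eq_right.mp heq)))
    have htop : R.toSubmodule ⊔ R'.toSubmodule = ⊤ := congr(($hR'.sup_eq_top).toSubmodule)
    have hsplit : P.toSubmodule = R.toSubmodule ⊔ R'.toSubmodule ⊓ P.toSubmodule := by
      rw [← sup_inf_assoc_of_le _ (show R.toSubmodule ≤ P.toSubmodule from hRP.le), htop,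
        top_inf_eq]
    rw [hsplit]
    exact sup_le (ih' R hRP) hsub

/-- If an irreducible representation of `K` occurs in the restriction to `K` of an irreducible
representation of `H ⊇ K`, and `K` contains the normal subgroup `I`, then `I` acts trivially on one
of them iff it acts trivially on the other. -/
theorem Representation.IsIrreducible.trivial_on_normal_iff {I K H : Subgroup G} [I.Normal]
    (hIK : I ≤ K) (hKH : K ≤ H) {σ : Representation ℂ K W} {ρ : Representation ℂ H V}
    (hσ : σ.IsIrreducible) (hρ : ρ.IsIrreducible)
    (f : IntertwiningMap σ (ρ.comp (Subgroup.inclusion hKH))) (hf : f ≠ 0) :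
    (∀ z : K, (z : G) ∈ I → σ z = 1) ↔ ∀ z : H, (z : G) ∈ I → ρ z = 1 := by
  have hinj : Function.Injective f := (injective_or_eq_zero f).resolve_right hf
  constructor
  · intro h
    let F : Subrepresentation ρ :=
      { toSubmodule := ⨅ (z : H) (_ : (z : G) ∈ I), LinearMap.eqLocus (ρ z) LinearMap.id
        apply_mem_toSubmodule := fun g v hv => by
          simp only [Submodule.mem_iInf, LinearMap.mem_eqLocus, LinearMap.id_apply] at hv ⊢
          intro z hz
          have hz' := hv (g⁻¹ * z * g) (by
            simpa using ‹I.Normal›.conj_mem z hz (g : G)⁻¹)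
          conv_rhs => rw [← hz']
          rw [← Module.End.mul_apply, ← Module.End.mul_apply, ← map_mul, ← map_mul]
          congr 2; group }
    have hF : F = ⊤ := by
      refine (hρ.eq_bot_or_eq_top F).resolve_left fun hbot => hf ?_
      ext w
      have hw : f w ∈ F.toSubmodule := by
        simp only [F, Submodule.mem_iInf, LinearMap.mem_eqLocus, LinearMap.id_apply]
        intro z hz
        have := f.isIntertwining _ _ ⟨(z : G), hIK hz⟩ w
        rw [h _ hz] at this
        exact this.symm
      rw [hbot] at hw
      exact (Submodule.mem_bot ℂ).mp hw
    intro z hz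
    ext v
    have hv : v ∈ F.toSubmodule := by rw [hF]; exact Submodule.mem_top
    simp only [F, Submodule.mem_iInf, LinearMap.mem_eqLocus, LinearMap.id_apply] at hv
    exact hv z hz
  · intro h z hz
    ext w
    apply hinj
    rw [f.isIntertwining]
    exact congr($(h (Subgroup.inclusion hKH z) hz) (f w))

end Subrepresentations

section Gamma

open Representation

variable {p e : ℕ} {G V W : Type*} [Group G] [Fintype G] [AddCommGroup V] [Module ℂ V]
  [FiniteDimensional ℂ V] [AddCommGroup W] [Module ℂ W] [FiniteDimensional ℂ W]

/-- The element of `Γ_{p,e}(G)` afforded by an irreducible representation of a subgroup. -/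
def GammaPair.ofRep {H : Subgroup G} (hH : p ^ (e + 1) ≤ Fintype.card H)
    (ρ : Representation ℂ H V) (hρ : ρ.IsIrreducible) : GammaPair p e G :=
  ⟨H, hH, ρ.character, isIrrChar_character ρ hρ⟩

/-- Every element of `Γ_{p,e}(G)` is afforded by an irreducible representation. -/
theorem GammaPair.exists_eq_ofRep (a : GammaPair p e G) :
    ∃ (n : ℕ) (ρ : Representation ℂ a.H (Fin n → ℂ)) (hρ : ρ.IsIrreducible),
      a = GammaPair.ofRep a.hH ρ hρ := by
  obtain ⟨H, hH, φ, hφ⟩ := a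
  obtain ⟨n, ρ, hρ, rfl⟩ := hφ.exists_representation
  exact ⟨n, ρ, hρ, rfl⟩

theorem gammaLe_ofRep_iff {K H : Subgroup G} (hK : p ^ (e + 1) ≤ Fintype.card K)
    (hH : p ^ (e + 1) ≤ Fintype.card H) {σ : Representation ℂ K W} (hσ : σ.IsIrreducible)
    {ρ : Representation ℂ H V} (hρ : ρ.IsIrreducible) :
    GammaLe (GammaPair.ofRep hK σ hσ) (GammaPair.ofRep hH ρ hρ) ↔
      ∃ (h : K ≤ H) (f : IntertwiningMap σ (ρ.comp (Subgroup.inclusion h))), f ≠ 0 :=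
  exists_congr fun h => charInner_character_ne_zero_iff σ (ρ.comp (Subgroup.inclusion h))

theorem gammaLe_ofRep_iff_exists_quotient {K H : Subgroup G}
    (hK : p ^ (e + 1) ≤ Fintype.card K) (hH : p ^ (e + 1) ≤ Fintype.card H)
    {σ : Representation ℂ K W} (hσ : σ.IsIrreducible)
    {ρ : Representation ℂ H V} (hρ : ρ.IsIrreducible) :
    GammaLe (GammaPair.ofRep hK σ hσ) (GammaPair.ofRep hH ρ hρ) ↔
      ∃ (h : K ≤ H) (f : IntertwiningMap (ρ.comp (Subgroup.inclusion h)) σ), f ≠ 0 :=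
  exists_congr fun h => charInner_ne_zero_comm.trans
    (charInner_character_ne_zero_iff (ρ.comp (Subgroup.inclusion h)) σ)

/-- The restriction of a representation of `G` to a subgroup. -/
abbrev resRep (ρ : Representation ℂ G V) (H : Subgroup G) : Representation ℂ H V :=
  ρ.comp H.subtype

/-- The sum of all irreducible `H`-subrepresentations of `ρ` that afford an element of `T`. -/
def isotypicSum (T : Set (GammaPair p e G)) (ρ : Representation ℂ G V) {H : Subgroup G}
    (hH : p ^ (e + 1) ≤ Fintype.card H) : Submodule ℂ V :=
  ⨆ (Q : Subrepresentation (resRep ρ H)) (hQ : Q.toRepresentation.IsIrreducible)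
    (_ : GammaPair.ofRep hH Q.toRepresentation hQ ∈ T), Q.toSubmodule

/-- A set of elements of `Γ_{p,e}(G)` that is a union of connected components. -/
def IsGammaClosed (T : Set (GammaPair p e G)) : Prop :=
  ∀ a b, GammaLe a b → (a ∈ T ↔ b ∈ T)

theorem IsGammaClosed.compl {T : Set (GammaPair p e G)} (hT : IsGammaClosed T) :
    IsGammaClosed Tᶜ := fun a b h => not_congr (hT a b h)

theorem le_isotypicSum {T : Set (GammaPair p e G)} {ρ : Representation ℂ G V} {H : Subgroup G}
    {hH : p ^ (e + 1) ≤ Fintype.card H} (Q : Subrepresentation (resRep ρ H))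
    (hQ : Q.toRepresentation.IsIrreducible)
    (h : GammaPair.ofRep hH Q.toRepresentation hQ ∈ T) :
    Q.toSubmodule ≤ isotypicSum T ρ hH :=
  le_iSup_of_le Q (le_iSup_of_le hQ (le_iSup_of_le h le_rfl))

theorem isotypicSum_invariant (T : Set (GammaPair p e G)) (ρ : Representation ℂ G V)
    {H : Subgroup G} (hH : p ^ (e + 1) ≤ Fintype.card H) (g : H) {v : V}
    (hv : v ∈ isotypicSum T ρ hH) : ρ g v ∈ isotypicSum T ρ hH := by
  suffices isotypicSum T ρ hH ≤ (isotypicSum T ρ hH).comap (ρ g) from this hv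
  exact iSup_le fun Q => iSup_le fun hQ => iSup_le fun h v hv =>
    le_isotypicSum Q hQ h (Q.apply_mem_toSubmodule g hv)

/-- The smaller the subgroup, the larger the isotypic sum of a union of components. -/
theorem isotypicSum_mono {T : Set (GammaPair p e G)} (hT : IsGammaClosed T)
    (ρ : Representation ℂ G V) {K H : Subgroup G} (hK : p ^ (e + 1) ≤ Fintype.card K)
    (hH : p ^ (e + 1) ≤ Fintype.card H) (hKH : K ≤ H) :
    isotypicSum T ρ hH ≤ isotypicSum T ρ hK := by
  refine iSup_le fun Q => iSup_le fun hQ => iSup_le fun h => ?_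
  let Q' : Subrepresentation (resRep ρ K) :=
    ⟨Q.toSubmodule, fun g _ hv => Q.apply_mem_toSubmodule (Subgroup.inclusion hKH g) hv⟩
  refine Q'.le_of_forall_irreducible_le _ fun R hRQ hR => le_isotypicSum R hR ?_
  refine (hT _ _ ((gammaLe_ofRep_iff hK hH hR hQ).mpr ⟨hKH, ?_, ?_⟩)).mpr h
  · exact LinearMap.intertwiningMap_of_isIntertwiningMap _ _
      (Submodule.inclusion (show R.toSubmodule ≤ Q.toSubmodule from hRQ)) fun _ _ => rfl
  · intro h0
    refine bot_ne_top (α := Subrepresentation R.toRepresentation) ?_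
    refine Subrepresentation.toSubmodule_injective
      ((Submodule.eq_bot_iff _).mpr fun v _ => ?_).symm
    exact Subtype.ext (congr_arg (Subtype.val : Q.toSubmodule → V) congr($h0 v))

theorem Subrepresentation.le_isotypicSum_sup (T : Set (GammaPair p e G))
    {ρ : Representation ℂ G V} {H : Subgroup G} (hH : p ^ (e + 1) ≤ Fintype.card H)
    (P : Subrepresentation (resRep ρ H)) :
    P.toSubmodule ≤ isotypicSum T ρ hH ⊓ P.toSubmodule ⊔ isotypicSum Tᶜ ρ hH ⊓ P.toSubmodule := by
  refine P.le_of_forall_irreducible_le _ fun Q hQP hQ => ?_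
  by_cases h : GammaPair.ofRep hH Q.toRepresentation hQ ∈ T
  · exact le_sup_of_le_left (le_inf (le_isotypicSum Q hQ h) hQP)
  · exact le_sup_of_le_right (le_inf (le_isotypicSum Q hQ h) hQP)

/-- If a `K`-equivariant map from `ρ` to an irreducible representation `σ` does not vanish on the
isotypic sum of a union `T` of components, then `σ` affords an element of `T`. -/
theorem IsGammaClosed.ofRep_mem {T : Set (GammaPair p e G)} (hT : IsGammaClosed T)
    {ρ : Representation ℂ G V} {K H : Subgroup G} (hK : p ^ (e + 1) ≤ Fintype.card K)
    (hH : p ^ (e + 1) ≤ Fintype.card H) (hKH : K ≤ H) {σ : Representation ℂ K W}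
    (hσ : σ.IsIrreducible) (f : IntertwiningMap (resRep ρ K) σ)
    (hf : ∃ v ∈ isotypicSum T ρ hH, f v ≠ 0) : GammaPair.ofRep hK σ hσ ∈ T := by
  by_contra hmem
  obtain ⟨v, hv, hfv⟩ := hf
  refine hfv ?_
  suffices isotypicSum T ρ hH ≤ LinearMap.ker f.toLinearMap from this hv
  refine iSup_le fun Q => iSup_le fun hQ => iSup_le fun h v hv => ?_
  let i : IntertwiningMap (Q.toRepresentation.comp (Subgroup.inclusion hKH)) (resRep ρ K) :=
    LinearMap.intertwiningMap_of_isIntertwiningMap _ _ Q.toSubmodule.subtype fun _ _ => rfl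
  by_contra hne
  refine hmem ((hT _ _ ((gammaLe_ofRep_iff_exists_quotient hK hH hσ hQ).mpr
    ⟨hKH, f.comp i, fun h0 => hne ?_⟩)).mpr h)
  exact congr($h0 ⟨v, hv⟩)

theorem IsGammaClosed.disjoint_isotypicSum {T : Set (GammaPair p e G)} (hT : IsGammaClosed T)
    (ρ : Representation ℂ G V) {H : Subgroup G} (hH : p ^ (e + 1) ≤ Fintype.card H) :
    Disjoint (isotypicSum T ρ hH) (isotypicSum Tᶜ ρ hH) := by
  rw [disjoint_iff_inf_le]
  let P : Subrepresentation (resRep ρ H) :=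
    ⟨isotypicSum T ρ hH ⊓ isotypicSum Tᶜ ρ hH, fun g _ hv =>
      ⟨isotypicSum_invariant T ρ hH g hv.1, isotypicSum_invariant Tᶜ ρ hH g hv.2⟩⟩
  refine P.le_of_forall_irreducible_le ⊥ fun Q hQP hQ v hv => ?_
  by_contra hv0
  obtain ⟨π, hπ⟩ := Q.exists_equivariant_projection
  have hne : π v ≠ 0 := fun h0 => hv0 <| by
    have := hπ ⟨v, hv⟩
    rw [h0] at this
    exact (Submodule.mem_bot ℂ).mpr (congr_arg Subtype.val this).symm
  exact hT.compl.ofRep_mem hH hH le_rfl hQ π ⟨v, (hQP hv).2, hne⟩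
    (hT.ofRep_mem hH hH le_rfl hQ π ⟨v, (hQP hv).1, hne⟩)

end Gamma

section RegularRepresentation

open Representation

variable {G W : Type*} [Group G] [AddCommGroup W] [Module ℂ W]

/-- The left regular representation on the space of functions on `G`. -/
def funRep (G : Type*) [Group G] : Representation ℂ G (G → ℂ) where
  toFun g := LinearMap.funLeft ℂ ℂ fun x => g⁻¹ * x
  map_one' := by ext; simp [LinearMap.funLeft]
  map_mul' g h := by ext; simp [LinearMap.funLeft, mul_assoc]

theorem funRep_apply (g : G) (f : G → ℂ) (x : G) : funRep G g f x = f (g⁻¹ * x) := rfl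

theorem funRep_single_one (g : G) : funRep G g (Pi.single 1 1) = Pi.single g 1 := by
  ext x
  simp [funRep_apply, Pi.single_apply, inv_mul_eq_one, eq_comm]

/-- The functions on `G` supported on `H`, as a representation of `H`. -/
def supportedSubrep (H : Subgroup G) : Subrepresentation (resRep (funRep G) H) where
  toSubmodule := ⨅ (x : G) (_ : x ∉ H), LinearMap.ker (LinearMap.proj (R := ℂ) (φ := fun _ => ℂ) x)
  apply_mem_toSubmodule g f hf := by
    simp only [Submodule.mem_iInf, LinearMap.mem_ker, LinearMap.proj_apply] at hf ⊢
    intro x hx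
    exact hf _ fun h => hx ((H.mul_mem_cancel_left (H.inv_mem g.2)).mp h)

theorem mem_supportedSubrep {H : Subgroup G} {f : G → ℂ} :
    f ∈ (supportedSubrep H).toSubmodule ↔ ∀ x ∉ H, f x = 0 := by
  simp [supportedSubrep]

variable [Fintype G]

/-- The `H`-equivariant map from functions on `G` to a representation of `H` that sends the
point mass at `1` to `w` and functions vanishing on `H` to `0`. -/
def funRepHom {H : Subgroup G} (σ : Representation ℂ H W) (w : W) :
    IntertwiningMap (resRep (funRep G) H) σ :=
  LinearMap.intertwiningMap_of_isIntertwiningMap _ _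
    (∑ h : H, (LinearMap.proj (R := ℂ) (φ := fun _ => ℂ) (h : G)).smulRight (σ h w)) fun k f => by
      simp only [LinearMap.sum_apply, LinearMap.smulRight_apply, LinearMap.proj_apply, map_sum,
        map_smul]
      refine Fintype.sum_equiv (Equiv.mulLeft k⁻¹) _ _ fun h => ?_
      rw [← Module.End.mul_apply, ← map_mul]
      simp [funRep_apply]

theorem funRepHom_apply {H : Subgroup G} (σ : Representation ℂ H W) (w : W) (f : G → ℂ) :
    funRepHom σ w f = ∑ h : H, f h • σ h w := by
  change (∑ h : H, (LinearMap.proj (R := ℂ) (φ := fun _ => ℂ) (h : G)).smulRight (σ h w)) f = _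
  simp

theorem funRepHom_single_one {H : Subgroup G} (σ : Representation ℂ H W) (w : W) :
    funRepHom σ w (Pi.single 1 1) = w := by
  rw [funRepHom_apply, Finset.sum_eq_single 1] <;> simp +contextual

variable {p e : ℕ}

/-- If the point mass at `1` lies in the isotypic sum of a union `T` of components,
then `T` is everything. -/
theorem IsGammaClosed.eq_univ {T : Set (GammaPair p e G)} (hT : IsGammaClosed T)
    (htop : p ^ (e + 1) ≤ Fintype.card (⊤ : Subgroup G))
    (h1 : Pi.single 1 1 ∈ isotypicSum T (funRep G) htop) : T = Set.univ := by
  refine Set.eq_univ_of_forall fun a => ?_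
  obtain ⟨n, σ, hσ, ha⟩ := a.exists_eq_ofRep
  have : Nontrivial (Fin n → ℂ) := by
    by_contra hn
    rw [not_nontrivial_iff_subsingleton] at hn
    exact bot_ne_top (α := Subrepresentation σ)
      (Subrepresentation.toSubmodule_injective (Subsingleton.elim _ _))
  obtain ⟨w, hw⟩ := exists_ne (0 : Fin n → ℂ)
  rw [ha]
  exact hT.ofRep_mem a.hH htop le_top hσ (funRepHom σ w)
    ⟨_, h1, by rwa [funRepHom_single_one]⟩

end RegularRepresentation

section Main

open Representation

variable {p e : ℕ} {G : Type*} [Group G] [Fintype G]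

theorem isGammaClosed_setOf_gammaConnected (a : GammaPair p e G) :
    IsGammaClosed {b | GammaConnected a b} := fun _ _ h =>
  ⟨fun hb => hb.trans _ _ _ (.rel _ _ (.inl h)), fun hc => hc.trans _ _ _ (.rel _ _ (.inr h))⟩

theorem IsGammaClosed.mem_iff_of_gammaConnected {T : Set (GammaPair p e G)}
    (hT : IsGammaClosed T) {a b : GammaPair p e G} (h : GammaConnected a b) :
    a ∈ T ↔ b ∈ T := by
  induction h with
  | rel _ _ h => exact h.elim (hT _ _) fun h => (hT _ _ h).symm
  | refl => rfl
  | symm _ _ _ ih => exact ih.symm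
  | trans _ _ _ _ _ ih₁ ih₂ => exact ih₁.trans ih₂

/-- If the subgroups of order at least `p ^ (e + 1)` intersect trivially, then the only nonempty
union of connected components of `Γ_{p,e}(G)` is `Γ_{p,e}(G)` itself. -/
theorem IsGammaClosed.eq_univ_of_nonempty {T : Set (GammaPair p e G)} (hT : IsGammaClosed T)
    (htop : p ^ (e + 1) ≤ Fintype.card (⊤ : Subgroup G))
    (hinf : ∀ x : G, (∀ H : Subgroup G, p ^ (e + 1) ≤ Fintype.card H → x ∈ H) → x = 1)
    (hne : T.Nonempty) : T = Set.univ := by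
  have h1 : (Pi.single 1 1 : G → ℂ) ∈
      isotypicSum T (funRep G) htop ⊔ isotypicSum Tᶜ (funRep G) htop := by
    have := Subrepresentation.le_isotypicSum_sup (ρ := funRep G) T htop ⊤
      (Submodule.mem_top : (Pi.single 1 1 : G → ℂ) ∈ _)
    exact (sup_le_sup inf_le_left inf_le_left :
      _ ≤ isotypicSum T (funRep G) htop ⊔ isotypicSum Tᶜ (funRep G) htop) this
  obtain ⟨u, hu, u', hu', huu'⟩ := Submodule.mem_sup.mp h1
  have hsupp (x : G) (hx : u x ≠ 0) : x = 1 := by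
    refine hinf x fun H hH => ?_
    have hδ : (Pi.single 1 1 : G → ℂ) ∈ (supportedSubrep H).toSubmodule :=
      mem_supportedSubrep.mpr fun y hy =>
        Pi.single_eq_of_ne (by rintro rfl; exact hy H.one_mem) _
    obtain ⟨v, hv, v', hv', hvv'⟩ :=
      Submodule.mem_sup.mp ((supportedSubrep H).le_isotypicSum_sup T hH hδ)
    have huH := isotypicSum_mono hT (funRep G) hH htop le_top hu
    have huH' := isotypicSum_mono hT.compl (funRep G) hH htop le_top hu'
    have hsub : u - v = v' - u' := by
      rw [sub_eq_sub_iff_add_eq_add, huu', add_comm, hvv']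
    have huv : u - v = 0 := Submodule.disjoint_def.mp (hT.disjoint_isotypicSum (funRep G) hH) _
      (sub_mem huH hv.1) (hsub ▸ sub_mem hv'.1 huH')
    by_contra hxH
    exact hx (by rw [sub_eq_zero.mp huv]; exact mem_supportedSubrep.mp hv.2 x hxH)
  have hu_eq : u = u 1 • Pi.single 1 1 := by
    ext x
    by_cases hx : x = 1
    · simp [hx]
    · simp [Pi.single_eq_of_ne hx, not_imp_comm.mp (hsupp x) hx]
  by_cases h0 : u 1 = 0
  · rw [h0, zero_smul] at hu_eq
    rw [hu_eq, zero_add] at huu'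
    have := hT.compl.eq_univ htop (huu' ▸ hu')
    exact absurd (Set.compl_univ_iff.mp this) hne.ne_empty
  · refine hT.eq_univ htop ?_
    rw [← inv_smul_smul₀ h0 (Pi.single 1 1), ← hu_eq]
    exact Submodule.smul_mem _ _ hu

/-- The elements of `Γ_{p,e}(G)` afforded by representations on which `I` acts trivially. -/
def trivialOn (p e : ℕ) (I : Subgroup G) : Set (GammaPair p e G) :=
  {a | ∀ (n : ℕ) (σ : Representation ℂ a.H (Fin n → ℂ)) (hσ : σ.IsIrreducible),
    a = GammaPair.ofRep a.hH σ hσ → ∀ z : a.H, (z : G) ∈ I → σ z = 1}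

theorem ofRep_mem_trivialOn_iff {V : Type*} [AddCommGroup V] [Module ℂ V] [FiniteDimensional ℂ V]
    {I H : Subgroup G} [I.Normal] (hIH : I ≤ H) (hH : p ^ (e + 1) ≤ Fintype.card H)
    {ρ : Representation ℂ H V} (hρ : ρ.IsIrreducible) :
    GammaPair.ofRep hH ρ hρ ∈ trivialOn p e I ↔ ∀ z : H, (z : G) ∈ I → ρ z = 1 := by
  have key (n : ℕ) (σ : Representation ℂ H (Fin n → ℂ)) (hσ : σ.IsIrreducible)
      (h : GammaPair.ofRep hH ρ hρ = GammaPair.ofRep hH σ hσ) :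
      (∀ z : H, (z : G) ∈ I → σ z = 1) ↔ ∀ z : H, (z : G) ∈ I → ρ z = 1 := by
    have hle : GammaLe (GammaPair.ofRep hH σ hσ) (GammaPair.ofRep hH ρ hρ) := by
      rw [h, gammaLe_ofRep_iff]
      refine ⟨le_rfl, IntertwiningMap.id σ, fun h0 => ?_⟩
      refine bot_ne_top (α := Subrepresentation σ) (Subrepresentation.toSubmodule_injective
        ((Submodule.eq_bot_iff _).mpr fun v _ => ?_).symm)
      exact congr($h0 v)
    obtain ⟨hle, f, hf⟩ := (gammaLe_ofRep_iff hH hH hσ hρ).mp hle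
    exact hσ.trivial_on_normal_iff hIH hle hρ f hf
  refine ⟨fun h => ?_, fun h n σ hσ heq => (key n σ hσ heq).mpr h⟩
  obtain ⟨n, σ, hσ, heq⟩ := (GammaPair.ofRep hH ρ hρ).exists_eq_ofRep
  exact (key n σ hσ heq).mp (h n σ hσ heq)

theorem isGammaClosed_trivialOn {I : Subgroup G} [I.Normal]
    (hI : ∀ H : Subgroup G, p ^ (e + 1) ≤ Fintype.card H → I ≤ H) :
    IsGammaClosed (trivialOn p e I) := by
  intro a b h
  obtain ⟨n, σ, hσ, ha⟩ := a.exists_eq_ofRep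
  obtain ⟨m, ρ, hρ, hb⟩ := b.exists_eq_ofRep
  rw [ha, hb, gammaLe_ofRep_iff] at h
  obtain ⟨hle, f, hf⟩ := h
  rw [ha, hb, ofRep_mem_trivialOn_iff (hI _ a.hH), ofRep_mem_trivialOn_iff (hI _ b.hH)]
  exact hσ.trivial_on_normal_iff (hI _ a.hH) hle hρ f hf

omit [Fintype G] in
theorem isIrreducible_trivial : (Representation.trivial ℂ G ℂ).IsIrreducible :=
  { exists_pair_ne := ⟨⊥, ⊤, fun h =>
      bot_ne_top (α := Submodule ℂ ℂ) congr(($h).toSubmodule)⟩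
    eq_bot_or_eq_top := fun P => (eq_bot_or_eq_top P.toSubmodule).imp
      (fun h => Subrepresentation.toSubmodule_injective h)
      fun h => Subrepresentation.toSubmodule_injective h }

/-- If `Γ_{p,e}(G)` is connected, then a normal subgroup contained in all subgroups of order at
least `p ^ (e + 1)` is trivial. -/
theorem eq_bot_of_gammaConnected {I : Subgroup G} [I.Normal]
    (hI : ∀ H : Subgroup G, p ^ (e + 1) ≤ Fintype.card H → I ≤ H)
    (htop : p ^ (e + 1) ≤ Fintype.card (⊤ : Subgroup G))
    (hconn : ∀ a b : GammaPair p e G, GammaConnected a b) : I = ⊥ := by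
  have hmem : GammaPair.ofRep htop _ isIrreducible_trivial ∈ trivialOn p e I :=
    (ofRep_mem_trivialOn_iff le_top htop _).mpr fun z _ => rfl
  have hall (b : GammaPair p e G) : b ∈ trivialOn p e I :=
    ((isGammaClosed_trivialOn hI).mem_iff_of_gammaConnected (hconn _ b)).mp hmem
  refine (Subgroup.eq_bot_iff_forall I).mpr fun z hz => ?_
  have hfix : Pi.single 1 1 ∈ LinearMap.eqLocus (funRep G z) LinearMap.id := by
    refine (⊤ : Subrepresentation (resRep (funRep G) ⊤)).le_of_forall_irreducible_le _
      (fun Q _ hQ v hv => ?_) Submodule.mem_top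
    have := (ofRep_mem_trivialOn_iff le_top htop hQ).mp (hall _) ⟨z, Subgroup.mem_top z⟩ hz
    exact congr_arg Subtype.val congr($this ⟨v, hv⟩)
  rw [LinearMap.mem_eqLocus, funRep_single_one, LinearMap.id_apply] at hfix
  by_contra hz1
  simpa [Pi.single_eq_of_ne hz1] using congr_fun hfix z

theorem normal_iInf_card_eq (n : ℕ) :
    (⨅ (H : Subgroup G) (_ : Fintype.card H = n), H).Normal where
  conj_mem x hx g := by
    simp only [Subgroup.mem_iInf] at hx ⊢
    intro H hH
    have h := hx (H.map (MulAut.conj g⁻¹).toMonoidHom) (by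
      rw [← hH]
      exact Fintype.card_congr (H.equivMapOfInjective _ (MulAut.conj g⁻¹).injective).toEquiv.symm)
    obtain ⟨y, hy, hyx⟩ := h
    convert hy
    rw [← hyx]
    simp [mul_assoc]

end Main

/-- main theorem, answering Question 2 of Meng–Yang: `Γ_{p,e}(G)`
is connected iff the intersection `I` of all subgroups of order `p^(e+1)` is
trivial. -/
theorem gamma_connected_iff_intersection_trivial {p e : ℕ} (hp : p.Prime)
    {G : Type*} [Group G] [Fintype G] (hG : IsPGroup p G)
    (hdvd : p ^ (e + 1) ∣ Fintype.card G)
    (I : Subgroup G)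
    (hI : I = ⨅ (H : Subgroup G) (_ : Fintype.card H = p ^ (e + 1)), H) :
    (∀ a b : GammaPair p e G, GammaConnected a b) ↔ I = ⊥ := by
  subst hI
  have := normal_iInf_card_eq (G := G) (p ^ (e + 1))
  have hle (H : Subgroup G) (hH : p ^ (e + 1) ≤ Fintype.card H) :
      (⨅ (H : Subgroup G) (_ : Fintype.card H = p ^ (e + 1)), H) ≤ H := by
    obtain ⟨K, hKH, hK⟩ := Sylow.exists_subgroup_le_card_pow_prime_of_le_card hp hG
      (hH.trans_eq Nat.card_eq_fintype_card.symm)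
    rw [Nat.card_eq_fintype_card] at hK
    exact (iInf₂_le K hK).trans hKH
  have htop : p ^ (e + 1) ≤ Fintype.card (⊤ : Subgroup G) := by
    rw [← Nat.card_eq_fintype_card, Subgroup.card_top, Nat.card_eq_fintype_card]
    exact Nat.le_of_dvd Fintype.card_pos hdvd
  refine ⟨eq_bot_of_gammaConnected hle htop, fun hbot a b => ?_⟩
  have huniv := (isGammaClosed_setOf_gammaConnected a).eq_univ_of_nonempty htop (fun x hx => ?_)
    ⟨a, .refl a⟩
  · exact huniv.ge (Set.mem_univ b)
  · rw [← Subgroup.mem_bot, ← hbot]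
    simp only [Subgroup.mem_iInf]
    exact fun H hH => hx H hH.ge
end
end
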